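/- arXiv:2207.09864 — 2 statements merged into one kernel-verified Lean document; each statement's English description precedes it below -/
import Mathlib

section
/- Let A be a commutative ℂ-algebra graded by ℕ × ℤ, with graded pieces A_{(m,k)}. Assume there exist a natural number n, elements g : Fin n → A, and weights w : Fin n → ℤ such that g i ∈ A_{(1, w i)} for every i and the g i generate A as a ℂ-algebra (Algebra.adjoin ℂ (range g) = ⊤). Then for all integers ρ₋ ≤ ρ₊, the truncation S(ρ₋,ρ₊) := ⊕_{m ∈ ℕ} ⊕_{k : m·ρ₋ ≤ k ≤ m·ρ₊} A_{(m,k)} is a finitely generated ℂ-algebra. -/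
theorem AddSubmonoid.fg_of_mem_iff_nonneg {M κ : Type*} [AddCommMonoid M] [PartialOrder M]
    [WellQuasiOrderedLE M] [IsOrderedCancelAddMonoid M] [CanonicallyOrderedAdd M] [Finite κ]
    (P : AddSubmonoid M) (f : M →+ (κ → ℤ)) (hP : ∀ v, v ∈ P ↔ ∀ j, 0 ≤ f v j) :
    P.FG := by
  let slack : (κ → ℕ) →+ (κ → ℤ) := (Nat.castAddMonoidHom ℤ).compLeft κ
  let E := AddMonoidHom.eqLocusM (f.comp (AddMonoidHom.fst M (κ → ℕ)))
    (slack.comp (AddMonoidHom.snd M (κ → ℕ)))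
  have hE : E.FG := AddSubmonoid.fg_eqLocusM _ _
  convert hE.map (AddMonoidHom.fst M (κ → ℕ))
  ext v
  rw [hP, AddSubmonoid.mem_map]
  constructor
  · intro h
    refine ⟨(v, fun j ↦ (f v j).toNat), ?_, rfl⟩
    change f v = fun j ↦ (((f v j).toNat : ℕ) : ℤ)
    ext j
    exact (Int.toNat_of_nonneg (h j)).symm
  · rintro ⟨⟨u, s⟩, h, rfl⟩ j
    have h' : f u = fun j ↦ (s j : ℤ) := h
    simp [h']

theorem Algebra.span_range_prod_pow_eq_top {R A κ : Type*} [CommSemiring R] [CommSemiring A]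
    [Algebra R A] [Fintype κ] (g : κ → A) (hgen : Algebra.adjoin R (Set.range g) = ⊤) :
    Submodule.span R (Set.range fun v : κ → ℕ ↦ ∏ i, g i ^ v i) = ⊤ := by
  rw [← top_le_iff, ← Algebra.top_toSubmodule, ← hgen, Algebra.adjoin_eq_span]
  refine Submodule.span_mono fun x hx ↦ ?_
  induction hx using Submonoid.closure_induction with
  | mem x hx =>
    classical
    obtain ⟨i, rfl⟩ := hx
    exact ⟨Pi.single i 1, by simp [Pi.single_apply, pow_ite]⟩
  | one => exact ⟨0, by simp⟩
  | mul x y _ _ hx hy =>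
    obtain ⟨u, rfl⟩ := hx
    obtain ⟨v, rfl⟩ := hy
    exact ⟨u + v, by simp [pow_add, Finset.prod_mul_distrib]⟩

/-- If a graded algebra is generated by finitely many homogeneous elements and the exponents of the
monomials with degree in a submonoid `C` form a finitely generated monoid, then the part of the
algebra with degrees in `C` is a finitely generated subalgebra. -/
theorem GradedAlgebra.exists_fg_subalgebra_eq_iSup {R A ι κ : Type*} [CommSemiring R]
    [CommSemiring A] [Algebra R A] [DecidableEq ι] [AddCommMonoid ι] [Fintype κ]
    (𝒜 : ι → Submodule R A) [GradedAlgebra 𝒜] (g : κ → A) (d : κ → ι)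
    (hg : ∀ i, g i ∈ 𝒜 (d i)) (hgen : Algebra.adjoin R (Set.range g) = ⊤)
    (C : AddSubmonoid ι) (P : AddSubmonoid (κ → ℕ))
    (hP : ∀ v, v ∈ P ↔ ∑ i, v i • d i ∈ C) (hfg : P.FG) :
    ∃ S : Subalgebra R A, Subalgebra.toSubmodule S = (⨆ p ∈ C, 𝒜 p) ∧ S.FG := by
  classical
  let mon : (κ → ℕ) → A := fun v ↦ ∏ i, g i ^ v i
  have mon_zero : mon 0 = 1 := by simp [mon]
  have mon_add (u v) : mon (u + v) = mon u * mon v := by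
    simp [mon, pow_add, Finset.prod_mul_distrib]
  have mon_mem (v) : mon v ∈ 𝒜 (∑ i, v i • d i) :=
    SetLike.prod_pow_mem_graded 𝒜 d g v fun i _ ↦ hg i
  obtain ⟨T, hT⟩ := hfg
  have mon_mem_adjoin : ∀ v ∈ P, mon v ∈ Algebra.adjoin R (mon '' T) := by
    intro v hv
    rw [← hT] at hv
    induction hv using AddSubmonoid.closure_induction with
    | mem v hv => exact Algebra.subset_adjoin ⟨v, hv, rfl⟩
    | zero => rw [mon_zero]; exact one_mem _
    | add u v _ _ hu hv => rw [mon_add]; exact mul_mem hu hv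
  have decompose_mem (p) (hp : p ∈ C) (x : A) :
      (DirectSum.decompose 𝒜 x p : A) ∈ Algebra.adjoin R (mon '' T) := by
    have hx : x ∈ Submodule.span R (Set.range mon) := by
      rw [Algebra.span_range_prod_pow_eq_top g hgen]; trivial
    induction hx using Submodule.span_induction with
    | mem x hx =>
      obtain ⟨v, rfl⟩ := hx
      by_cases h : ∑ i, v i • d i = p
      · have hv : v ∈ P := by rwa [hP, h]
        rw [DirectSum.decompose_of_mem_same 𝒜 (h ▸ mon_mem v)]
        exact mon_mem_adjoin v hv
      · rw [DirectSum.decompose_of_mem_ne 𝒜 (mon_mem v) h]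
        exact zero_mem _
    | zero => simp
    | add x y _ _ hx hy => simpa using add_mem hx hy
    | smul a x _ hx =>
      rw [DirectSum.decompose_smul]
      exact Subalgebra.smul_mem _ hx a
  refine ⟨Algebra.adjoin R (mon '' T), le_antisymm ?_ ?_, T.image mon, by simp⟩
  · rw [Algebra.adjoin_eq_span, Submodule.span_le]
    intro x hx
    have hx' : ∃ v ∈ P, mon v = x := by
      induction hx using Submonoid.closure_induction with
      | mem x hx =>
        obtain ⟨v, hv, rfl⟩ := hx
        exact ⟨v, hT ▸ AddSubmonoid.subset_closure hv, rfl⟩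
      | one => exact ⟨0, zero_mem P, mon_zero⟩
      | mul x y _ _ hx hy =>
        obtain ⟨u, hu, rfl⟩ := hx
        obtain ⟨v, hv, rfl⟩ := hy
        exact ⟨u + v, add_mem hu hv, mon_add u v⟩
    obtain ⟨v, hv, rfl⟩ := hx'
    exact Submodule.mem_iSup_of_mem _ (Submodule.mem_iSup_of_mem ((hP v).1 hv) (mon_mem v))
  · refine iSup₂_le fun p hp x hx ↦ ?_
    rw [← DirectSum.decompose_of_mem_same 𝒜 hx]
    exact decompose_mem p hp x


/-- Lemma 3.2 of the paper (algebraic form): if a commutative ℂ-algebra `A` graded by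
`ℕ × ℤ` is generated by finitely many homogeneous elements of degrees `(1, w i)`, then for
all integers `ρ₋ ≤ ρ₊` the truncation `⊕_{m} ⊕_{m·ρ₋ ≤ k ≤ m·ρ₊} A_{(m,k)}` is a finitely
generated ℂ-algebra. -/
theorem stmt_2 {A : Type*} [CommRing A] [Algebra ℂ A]
    (𝒜 : ℕ × ℤ → Submodule ℂ A) [GradedAlgebra 𝒜]
    (n : ℕ) (g : Fin n → A) (w : Fin n → ℤ)
    (hg : ∀ i, g i ∈ 𝒜 (1, w i))
    (hgen : Algebra.adjoin ℂ (Set.range g) = ⊤)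
    (ρm ρp : ℤ) (hρ : ρm ≤ ρp) :
    ∃ S : Subalgebra ℂ A,
      Subalgebra.toSubmodule S =
        (⨆ (p : ℕ × ℤ) (_ : (p.1 : ℤ) * ρm ≤ p.2 ∧ p.2 ≤ (p.1 : ℤ) * ρp), 𝒜 p) ∧
      S.FG := by
  let slope : ℕ × ℤ →+ (Bool → ℤ) :=
    { toFun := fun p b ↦ if b then p.2 - p.1 * ρm else p.1 * ρp - p.2
      map_zero' := by ext b; cases b <;> simp
      map_add' := fun p q ↦ by ext b; cases b <;> simp <;> ring }
  have slope_nonneg (p : ℕ × ℤ) :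
      (∀ b, 0 ≤ slope p b) ↔ (p.1 : ℤ) * ρm ≤ p.2 ∧ p.2 ≤ (p.1 : ℤ) * ρp := by
    simp [slope, and_comm]
  let C : AddSubmonoid (ℕ × ℤ) := (AddSubmonoid.nonneg (Bool → ℤ)).comap slope
  have mem_C (p : ℕ × ℤ) : p ∈ C ↔ ∀ b, 0 ≤ slope p b := Iff.rfl
  let deg : (Fin n → ℕ) →+ ℕ × ℤ :=
    { toFun := fun v ↦ ∑ i, v i • ((1, w i) : ℕ × ℤ)
      map_zero' := by simp
      map_add' := fun u v ↦ by simp only [Pi.add_apply, add_smul, Finset.sum_add_distrib] }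
  have hfg : (C.comap deg).FG :=
    AddSubmonoid.fg_of_mem_iff_nonneg _ (slope.comp deg) fun _ ↦ Iff.rfl
  simpa only [mem_C, slope_nonneg] using
    GradedAlgebra.exists_fg_subalgebra_eq_iSup 𝒜 g (fun i ↦ (1, w i)) hg hgen C _
      (fun _ ↦ Iff.rfl) hfg
end

section
/- Let A be a commutative ℂ-algebra graded by ℕ × ℤ, with graded pieces A_{(m,k)}, and let ρ₋ ≤ ρ₊ be integers. Let f ∈ A be homogeneous of degree (m₀, k₀) with m₀ ≥ 1 and m₀·ρ₋ < k₀ < m₀·ρ₊. Then for every (m,k) ∈ ℕ × ℤ and every homogeneous element g ∈ A_{(m,k)}, there exists ℓ ∈ ℕ such that f^ℓ · g belongs to the truncation S(ρ₋,ρ₊); equivalently, (m + ℓ·m₀)·ρ₋ ≤ k + ℓ·k₀ ≤ (m + ℓ·m₀)·ρ₊. -/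
/-- Key claim in Step 2 (normality) of the proof of Theorem 3.5 of the paper: if `f` is
homogeneous of interior bidegree `(m₀, k₀)` (i.e. `m₀ ≥ 1` and `m₀·ρ₋ < k₀ < m₀·ρ₊`), then
any homogeneous element `g ∈ A_{(m,k)}` can be pushed into the truncation
`S(ρ₋,ρ₊) = ⊕_{m} ⊕_{m·ρ₋ ≤ k ≤ m·ρ₊} A_{(m,k)}` by multiplying by a sufficiently high
power of `f`. -/
theorem stmt_4 {A : Type*} [CommRing A] [Algebra ℂ A]
    (𝒜 : ℕ × ℤ → Submodule ℂ A) [GradedAlgebra 𝒜]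
    (ρm ρp : ℤ) (hρ : ρm ≤ ρp)
    (m₀ : ℕ) (k₀ : ℤ) (f : A) (hf : f ∈ 𝒜 (m₀, k₀))
    (hm₀ : 1 ≤ m₀) (hk₀m : (m₀ : ℤ) * ρm < k₀) (hk₀p : k₀ < (m₀ : ℤ) * ρp)
    (m : ℕ) (k : ℤ) (g : A) (hg : g ∈ 𝒜 (m, k)) :
    ∃ ℓ : ℕ,
      f ^ ℓ * g ∈
        (⨆ (p : ℕ × ℤ) (_ : (p.1 : ℤ) * ρm ≤ p.2 ∧ p.2 ≤ (p.1 : ℤ) * ρp), 𝒜 p) ∧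
      ((m : ℤ) + ℓ * m₀) * ρm ≤ k + ℓ * k₀ ∧
      k + ℓ * k₀ ≤ ((m : ℤ) + ℓ * m₀) * ρp := by
  obtain ⟨ℓ, h₁, h₂⟩ : ∃ ℓ : ℕ, (m : ℤ) * ρm - k ≤ ℓ ∧ k - (m : ℤ) * ρp ≤ ℓ :=
    ⟨((m : ℤ) * ρm - k).toNat + (k - (m : ℤ) * ρp).toNat, by omega, by omega⟩
  have hℓ : (0 : ℤ) ≤ ℓ := Int.natCast_nonneg ℓ
  have hm : ((m : ℤ) + ℓ * m₀) * ρm ≤ k + ℓ * k₀ := by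
    nlinarith [mul_le_mul_of_nonneg_left (Int.add_one_le_iff.mpr hk₀m) hℓ]
  have hp : k + ℓ * k₀ ≤ ((m : ℤ) + ℓ * m₀) * ρp := by
    nlinarith [mul_le_mul_of_nonneg_left (Int.add_one_le_iff.mpr hk₀p) hℓ]
  have hmem : f ^ ℓ * g ∈ 𝒜 (m + ℓ * m₀, k + ℓ * k₀) := by
    convert SetLike.mul_mem_graded (SetLike.pow_mem_graded ℓ hf) hg using 2
    ext <;> simp [add_comm]
  refine ⟨ℓ, Submodule.mem_iSup_of_mem (m + ℓ * m₀, k + ℓ * k₀) ?_, hm, hp⟩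
  exact Submodule.mem_iSup_of_mem ⟨by push_cast; exact hm, by push_cast; exact hp⟩ hmem
end
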